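/- Let F ∈ ℤ[T] with F(0) ∈ {−1, 1}, and let d be a positive integer. Then there exist r ≥ 0, pairwise distinct positive integers n₁,…,n_r each of the special form (nᵢ = pᵢmᵢ with pᵢ prime and mᵢ dividing pᵢ−1), and a sign ε ∈ {−1, 1}, such that F ≡ ε·Φ_{n₁}(T)·Φ_{n₂}(T)⋯Φ_{n_r}(T) (mod T^d) in ℤ[T]. -/

import Mathlib

open Polynomial

/-- A positive integer is of the special form if it is `p * m` with `p` prime and
`m` dividing `p − 1`. -/
def SpecialForm (n : ℕ) : Prop :=
  ∃ p m : ℕ, p.Prime ∧ m ∣ p - 1 ∧ n = p * m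

theorem SpecialForm.of_dvd {p m : ℕ} (hp : p.Prime) (hm : m ∣ p - 1) : SpecialForm (m * p) :=
  ⟨p, m, hp, hm, mul_comm m p⟩

/-- There are arbitrarily large primes `p` with `k ∣ p - 1`. -/
theorem exists_prime_gt_dvd_sub_one {k : ℕ} (hk : k ≠ 0) (N : ℕ) :
    ∃ p : ℕ, p.Prime ∧ N < p ∧ k ∣ p - 1 := by
  obtain ⟨p, hp, hN, h⟩ := Nat.exists_prime_gt_modEq_one N hk
  exact ⟨p, hp, hN, (Nat.modEq_iff_dvd' hp.one_le).1 h.symm⟩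

theorem prod_cyclotomic_mul_prime {p : ℕ} (hp : p.Prime) (s : Finset ℕ)
    (hs : ∀ m ∈ s, ¬ p ∣ m) :
    (∏ m ∈ s, cyclotomic (m * p) ℤ) * ∏ m ∈ s, cyclotomic m ℤ =
      expand ℤ p (∏ m ∈ s, cyclotomic m ℤ) := by
  rw [map_prod, ← Finset.prod_mul_distrib]
  exact Finset.prod_congr rfl fun m hm =>
    (cyclotomic_expand_eq_cyclotomic_mul hp (hs m hm) ℤ).symm

theorem X_pow_dvd_expand {k p : ℕ} (hk : 0 < k) (hp : 2 ≤ p) {f : ℤ[X]}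
    (hf : X ^ k ∣ f) : X ^ (k + 1) ∣ expand ℤ p f := by
  obtain ⟨g, rfl⟩ := hf
  rw [map_mul, map_pow, expand_X, ← pow_mul]
  exact Dvd.dvd.mul_right (pow_dvd_pow X (by nlinarith)) _

theorem X_pow_dvd_prod_cyclotomic_divisors_mul_prime {k p : ℕ} (hk : 0 < k) (hp : p.Prime)
    (hkp : k < p) :
    (X : ℤ[X]) ^ (k + 1) ∣ (∏ m ∈ k.divisors, cyclotomic (m * p) ℤ) - (1 + X ^ k) := by
  have h := prod_cyclotomic_mul_prime hp k.divisors fun m hm hpm =>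
    (hkp.trans_le (Nat.le_of_dvd hk (hpm.trans (Nat.dvd_of_mem_divisors hm)))).false
  rw [prod_cyclotomic_eq_X_pow_sub_one hk] at h
  obtain ⟨g, hg⟩ := X_pow_dvd_expand hk hp.two_le (dvd_refl (X ^ k : ℤ[X]))
  obtain ⟨j, rfl⟩ := Nat.exists_eq_add_of_lt hk
  set P := ∏ m ∈ (0 + j + 1).divisors, cyclotomic (m * p) ℤ
  rw [map_sub, map_one, hg] at h
  refine ⟨X ^ j * (P - X * g) - g, ?_⟩
  linear_combination (-1 - X ^ (0 + j + 1)) * h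

theorem X_pow_dvd_prod_cyclotomic_divisors_mul_prime_mul_prime {k p q : ℕ} (hk : 0 < k)
    (hq : q.Prime) (hkq : k < q) (hp : p.Prime) (hp' : k * q < p) :
    (X : ℤ[X]) ^ (k + 1) ∣ (∏ m ∈ k.divisors, cyclotomic (m * q * p) ℤ) - (1 - X ^ k) := by
  have hinj : Set.InjOn (fun m => m * q) (k.divisors : Set ℕ) := fun a _ b _ h =>
    Nat.eq_of_mul_eq_mul_right hq.pos h
  have h := prod_cyclotomic_mul_prime hp (k.divisors.image fun m => m * q) (by
    simp only [Finset.mem_image]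
    rintro _ ⟨m, hm, rfl⟩ hpm
    have := Nat.le_of_dvd (Nat.mul_pos hk hq.pos)
      (hpm.trans (Nat.mul_dvd_mul_right (Nat.dvd_of_mem_divisors hm) q))
    exact (hp'.trans_le this).false)
  rw [Finset.prod_image hinj, Finset.prod_image hinj] at h
  obtain ⟨e, he⟩ := X_pow_dvd_prod_cyclotomic_divisors_mul_prime hk hq hkq
  obtain ⟨g, hg⟩ := X_pow_dvd_expand (f := X ^ k * (1 + X * e)) hk hp.two_le (dvd_mul_right _ _)
  rw [eq_add_of_sub_eq he, show X ^ (k + 1) * e + (1 + X ^ k) = X ^ k * (1 + X * e) + 1 by ring,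
    map_add, map_one, hg] at h
  obtain ⟨j, rfl⟩ := Nat.exists_eq_add_of_lt hk
  set P := ∏ m ∈ (0 + j + 1).divisors, cyclotomic (m * q * p) ℤ
  refine ⟨(1 - X ^ (0 + j + 1)) * (g - P * e) + P * X ^ j, ?_⟩
  linear_combination (1 - X ^ (0 + j + 1)) * h

theorem exists_prod_cyclotomic_one_add_X_pow {k : ℕ} (hk : 0 < k) (N : ℕ) :
    ∃ s : Finset ℕ, (∀ n ∈ s, N < n ∧ SpecialForm n) ∧
      (X : ℤ[X]) ^ (k + 1) ∣ (∏ n ∈ s, cyclotomic n ℤ) - (1 + X ^ k) := by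
  obtain ⟨p, hp, hN, hdvd⟩ := exists_prime_gt_dvd_sub_one hk.ne' (N + k)
  refine ⟨k.divisors.image fun m => m * p, ?_, ?_⟩
  · simp only [Finset.mem_image]
    rintro _ ⟨m, hm, rfl⟩
    have := Nat.le_mul_of_pos_left p (Nat.pos_of_mem_divisors hm)
    exact ⟨by omega, .of_dvd hp ((Nat.dvd_of_mem_divisors hm).trans hdvd)⟩
  · rw [Finset.prod_image fun a _ b _ h => Nat.eq_of_mul_eq_mul_right hp.pos h]
    exact X_pow_dvd_prod_cyclotomic_divisors_mul_prime hk hp (by omega)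

theorem exists_prod_cyclotomic_one_sub_X_pow {k : ℕ} (hk : 0 < k) (N : ℕ) :
    ∃ s : Finset ℕ, (∀ n ∈ s, N < n ∧ SpecialForm n) ∧
      (X : ℤ[X]) ^ (k + 1) ∣ (∏ n ∈ s, cyclotomic n ℤ) - (1 - X ^ k) := by
  obtain ⟨q, hq, hkq⟩ := Nat.exists_infinite_primes (k + 1)
  obtain ⟨p, hp, hN, hdvd⟩ :=
    exists_prime_gt_dvd_sub_one (Nat.mul_pos hk hkq.pos).ne' (N + k * q)
  refine ⟨k.divisors.image fun m => m * q * p, ?_, ?_⟩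
  · simp only [Finset.mem_image]
    rintro _ ⟨m, hm, rfl⟩
    have := Nat.le_mul_of_pos_left p (Nat.mul_pos (Nat.pos_of_mem_divisors hm) hkq.pos)
    exact ⟨by omega,
      .of_dvd hp ((Nat.mul_dvd_mul_right (Nat.dvd_of_mem_divisors hm) q).trans hdvd)⟩
  · rw [Finset.prod_image fun a _ b _ h => Nat.eq_of_mul_eq_mul_right hkq.pos
      (Nat.eq_of_mul_eq_mul_right hp.pos h)]
    exact X_pow_dvd_prod_cyclotomic_divisors_mul_prime_mul_prime hk hkq (by omega) hp (by omega)

/-- Two families of indices, the second one beyond the first, have a disjoint union. -/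
theorem prod_union_of_sup_lt {s t : Finset ℕ} {N : ℕ} (h : ∀ n ∈ t, max N (s.sup id) < n)
    (f : ℕ → ℤ[X]) : ∏ n ∈ s ∪ t, f n = (∏ n ∈ s, f n) * ∏ n ∈ t, f n := by
  refine Finset.prod_union (Finset.disjoint_left.2 fun n hs ht => ?_)
  have h₁ : n ≤ s.sup id := Finset.le_sup (f := id) hs
  have h₂ := h n ht
  omega

theorem exists_prod_cyclotomic_one_add_C_mul_X_pow {k : ℕ} (hk : 0 < k) (N : ℕ) (a : ℤ) :
    ∃ s : Finset ℕ, (∀ n ∈ s, N < n ∧ SpecialForm n) ∧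
      (X : ℤ[X]) ^ (k + 1) ∣ (∏ n ∈ s, cyclotomic n ℤ) - (1 + C a * X ^ k) := by
  have step : ∀ a c : ℤ,
      (∃ s : Finset ℕ, (∀ n ∈ s, N < n ∧ SpecialForm n) ∧
        (X : ℤ[X]) ^ (k + 1) ∣ (∏ n ∈ s, cyclotomic n ℤ) - (1 + C a * X ^ k)) →
      (∀ M : ℕ, ∃ s : Finset ℕ, (∀ n ∈ s, M < n ∧ SpecialForm n) ∧
        (X : ℤ[X]) ^ (k + 1) ∣ (∏ n ∈ s, cyclotomic n ℤ) - (1 + C c * X ^ k)) →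
      ∃ s : Finset ℕ, (∀ n ∈ s, N < n ∧ SpecialForm n) ∧
        (X : ℤ[X]) ^ (k + 1) ∣ (∏ n ∈ s, cyclotomic n ℤ) - (1 + C (a + c) * X ^ k) := by
    rintro a c ⟨s, hs, e, he⟩ H
    obtain ⟨t, ht, g, hg⟩ := H (max N (s.sup id))
    refine ⟨s ∪ t, fun n hn => ?_, ?_⟩
    · rcases Finset.mem_union.1 hn with hn | hn
      · exact hs n hn
      · exact ⟨(le_max_left _ _).trans_lt (ht n hn).1, (ht n hn).2⟩
    · rw [prod_union_of_sup_lt fun n hn => (ht n hn).1, C_add]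
      obtain ⟨j, rfl⟩ := Nat.exists_eq_add_of_lt hk
      refine ⟨e * ∏ n ∈ t, cyclotomic n ℤ + (1 + C a * X ^ (0 + j + 1)) * g
        + C a * C c * X ^ j, ?_⟩
      linear_combination (∏ n ∈ t, cyclotomic n ℤ) * he + (1 + C a * X ^ (0 + j + 1)) * hg
  induction a using Int.induction_on with
  | zero => exact ⟨∅, by simp, by simp⟩
  | succ i ih =>
    exact step _ 1 ih fun M => by simpa using exists_prod_cyclotomic_one_add_X_pow hk M
  | pred i ih =>
    rw [sub_eq_add_neg]
    exact step _ (-1) ih fun M => by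
      simpa [← sub_eq_add_neg] using exists_prod_cyclotomic_one_sub_X_pow hk M

theorem exists_X_pow_dvd_sub_prod_cyclotomic {F : ℤ[X]} (hF : F.eval 0 = 1) (d : ℕ) :
    ∃ s : Finset ℕ, (∀ n ∈ s, 0 < n ∧ SpecialForm n) ∧
      (X : ℤ[X]) ^ (d + 1) ∣ F - ∏ n ∈ s, cyclotomic n ℤ := by
  induction d with
  | zero => exact ⟨∅, by simp, by simp [X_dvd_iff, coeff_zero_eq_eval_zero, hF]⟩
  | succ d ih =>
    obtain ⟨s, hs, G, hG⟩ := ih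
    obtain ⟨t, ht, g, hg⟩ := exists_prod_cyclotomic_one_add_C_mul_X_pow (k := d + 1) d.succ_pos
      (max 0 (s.sup id)) (G.coeff 0)
    refine ⟨s ∪ t, fun n hn => ?_, ?_⟩
    · rcases Finset.mem_union.1 hn with hn | hn
      · exact hs n hn
      · exact ⟨(le_max_left _ _).trans_lt (ht n hn).1, (ht n hn).2⟩
    · rw [prod_union_of_sup_lt fun n hn => (ht n hn).1]
      obtain ⟨e, he⟩ : X ∣ G - C (G.coeff 0) := by simp [X_dvd_iff]
      obtain ⟨f, hf⟩ : X ∣ F - 1 := by simp [X_dvd_iff, coeff_zero_eq_eval_zero, hF]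
      set P := ∏ n ∈ s, cyclotomic n ℤ
      set Q := ∏ n ∈ t, cyclotomic n ℤ
      set c := C (G.coeff 0)
      refine ⟨e - P * g - c * f + c * X ^ d * G, ?_⟩
      linear_combination hG * (1 + c * X ^ (d + 1)) + X ^ (d + 1) * he - P * hg
        - c * X ^ (d + 1) * hf

/-- every integer polynomial with constant term `±1` is congruent
modulo `T^d` to `±` a product of distinct cyclotomic polynomials of special form. -/
theorem congruent_to_special_root_of_unity_polynomial
    (F : Polynomial ℤ) (hF : F.eval 0 = 1 ∨ F.eval 0 = -1)
    (d : ℕ) (hd : 0 < d) :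
    ∃ (r : ℕ) (n : Fin r → ℕ) (ε : ℤ), Function.Injective n ∧
      (∀ i, 0 < n i ∧ SpecialForm (n i)) ∧ (ε = 1 ∨ ε = -1) ∧
      (X : Polynomial ℤ) ^ d ∣
        F - Polynomial.C ε * ∏ i, Polynomial.cyclotomic (n i) ℤ := by
  obtain ⟨ε, hε, hF⟩ : ∃ ε : ℤ, (ε = 1 ∨ ε = -1) ∧ (C ε * F).eval 0 = 1 := by
    rcases hF with h | h
    · exact ⟨1, .inl rfl, by simp [h]⟩
    · exact ⟨-1, .inr rfl, by simp [h]⟩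
  obtain ⟨s, hs, hdvd⟩ := exists_X_pow_dvd_sub_prod_cyclotomic hF d
  have hprod : ∏ i, cyclotomic (s.equivFin.symm i : ℕ) ℤ = ∏ n ∈ s, cyclotomic n ℤ := by
    rw [s.equivFin.symm.prod_comp fun n : s => cyclotomic (n : ℕ) ℤ]
    exact Finset.prod_coe_sort s fun n => cyclotomic n ℤ
  refine ⟨s.card, fun i => s.equivFin.symm i, ε,
    Subtype.val_injective.comp s.equivFin.symm.injective,
    fun i => hs _ (s.equivFin.symm i).2, hε, ?_⟩
  rw [hprod]
  have hεε : C ε * C ε = (1 : ℤ[X]) := by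
    rcases hε with rfl | rfl <;> simp
  have h := ((pow_dvd_pow X d.le_succ).trans hdvd).mul_left (C ε)
  rwa [mul_sub, ← mul_assoc, hεε, one_mul] at h
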